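/- Let q ≥ 2 and λ ≥ 0 be integers, let r be an integer, and let I be a finite interval of nonnegative integers such that n + r ≥ 0 for all n ∈ I. Then #{n ∈ I : s_q(n+r) − s_q(n) ≠ s_{q,λ}(n+r) − s_{q,λ}(n)} ≤ |I|·|r|/q^λ + |r|, where |I| denotes the number of integers in I. -/

import Mathlib

open scoped BigOperators

/-- `s q n` is the sum of digits of `n` in base `q`. -/
def s (q n : ℕ) : ℕ := (Nat.digits q n).sum

/-- The truncated sum-of-digits function `s_{q,λ}`, extended `q^λ`-periodically to `ℤ`:
`sTrunc q lam n = s_q (n mod q^λ)`. -/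
def sTrunc (q lam : ℕ) (n : ℤ) : ℕ := s q ((n % (q : ℤ) ^ lam).toNat)

theorem s_eq_mod_add_div {q : ℕ} (hq : 2 ≤ q) (n : ℕ) : s q n = n % q + s q (n / q) := by
  rcases Nat.eq_zero_or_pos n with rfl | hn
  · simp [s]
  · simp [s, Nat.digits_def' hq hn]

theorem s_eq_mod_pow_add_div_pow {q : ℕ} (hq : 2 ≤ q) (k n : ℕ) :
    s q n = s q (n % q ^ k) + s q (n / q ^ k) := by
  induction k generalizing n with
  | zero => simp [s, Nat.mod_one]
  | succ k ih =>
    rw [s_eq_mod_add_div hq n, ih (n / q), s_eq_mod_add_div hq (n % q ^ (k + 1)), pow_succ',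
      Nat.mod_mul_right_mod, Nat.mod_mul_right_div_self, Nat.div_div_eq_div_mul, add_assoc]

theorem s_toNat_eq_sTrunc_add {q : ℕ} (hq : 2 ≤ q) (k : ℕ) {n : ℤ} (hn : 0 ≤ n) :
    s q n.toNat = sTrunc q k n + s q (n / (q : ℤ) ^ k).toNat := by
  lift n to ℕ using hn
  have h := s_eq_mod_pow_add_div_pow hq k n
  unfold sTrunc
  exact_mod_cast h

theorem card_filter_emod_eq_le {Q : ℤ} (hQ : 0 < Q) (a b c : ℤ) :
    (((Finset.Icc a b).filter (fun n => n % Q = c)).card : ℝ)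
      ≤ ((Finset.Icc a b).card : ℝ) / Q + 1 := by
  have hQ' : (0 : ℚ) < Q := by exact_mod_cast hQ
  have hsub : (Finset.Icc a b).filter (fun n => n % Q = c) ⊆
      (Finset.Ioc (a - 1) b).filter (fun n => n ≡ c [ZMOD Q]) := by
    intro n hn
    simp only [Finset.mem_filter, Finset.mem_Icc, Finset.mem_Ioc] at hn ⊢
    obtain ⟨⟨h1, h2⟩, rfl⟩ := hn
    exact ⟨⟨by lia, h2⟩, (Int.mod_modEq n Q).symm⟩
  have hcard := Int.Ioc_filter_modEq_card (a - 1) b hQ c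
  have hI : ((b + 1 - a : ℤ) : ℚ) ≤ ((Finset.Icc a b).card : ℚ) := by
    rw [Int.card_Icc]
    exact_mod_cast Int.self_le_toNat (b + 1 - a)
  have key : ((((Finset.Ioc (a - 1) b).filter (fun n => n ≡ c [ZMOD Q])).card : ℤ) : ℚ)
      ≤ ((Finset.Icc a b).card : ℚ) / Q + 1 := by
    rw [hcard]
    push_cast
    refine max_le ?_ (by positivity)
    have h1 := Int.floor_le (((b : ℚ) - c) / Q)
    have h2 := Int.lt_floor_add_one ((((a : ℚ) - 1) - c) / Q)
    have h3 : ((b + 1 - a : ℤ) : ℚ) / Q ≤ ((Finset.Icc a b).card : ℚ) / Q := by gcongr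
    have h4 : ((b + 1 - a : ℤ) : ℚ) / Q = ((b : ℚ) - c) / Q - (((a : ℚ) - 1) - c) / Q := by
      push_cast
      ring
    linarith
  have key' : (((Finset.Ioc (a - 1) b).filter (fun n => n ≡ c [ZMOD Q])).card : ℝ)
      ≤ ((Finset.Icc a b).card : ℝ) / Q + 1 := by exact_mod_cast key
  exact le_trans (by exact_mod_cast Finset.card_le_card hsub) key'

theorem exists_residues_of_ediv_ne {Q : ℤ} (hQ : 0 < Q) (r : ℤ) :
    ∃ R : Finset ℤ, R.card = r.natAbs ∧ ∀ n : ℤ, (n + r) / Q ≠ n / Q → n % Q ∈ R := by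
  rcases le_total 0 r with hr | hr
  · refine ⟨Finset.Ico (Q - r) Q, by rw [Int.card_Ico]; lia, fun n hn => ?_⟩
    have h1 := Int.emod_lt_of_pos n hQ
    have h0 := Int.emod_nonneg n hQ.ne'
    rw [Finset.mem_Ico]
    refine ⟨?_, h1⟩
    by_contra! h
    refine hn ((Int.ediv_emod_unique (r := n % Q + r) hQ).2 ⟨?_, by lia, by lia⟩).1
    linarith [Int.emod_add_mul_ediv n Q]
  · refine ⟨Finset.Ico 0 (-r), by rw [Int.card_Ico]; lia, fun n hn => ?_⟩
    have h1 := Int.emod_lt_of_pos n hQ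
    have h0 := Int.emod_nonneg n hQ.ne'
    rw [Finset.mem_Ico]
    refine ⟨h0, ?_⟩
    by_contra! h
    refine hn ((Int.ediv_emod_unique (r := n % Q + r) hQ).2 ⟨?_, by lia, by lia⟩).1
    linarith [Int.emod_add_mul_ediv n Q]

theorem stmt_9 (q lam : ℕ) (hq : 2 ≤ q) (r a b : ℤ)
    (hI : ∀ n ∈ Finset.Icc a b, 0 ≤ n ∧ 0 ≤ n + r) :
    (((Finset.Icc a b).filter (fun n =>
        (s q (n + r).toNat : ℤ) - (s q n.toNat : ℤ) ≠
        (sTrunc q lam (n + r) : ℤ) - (sTrunc q lam n : ℤ))).card : ℝ)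
    ≤ ((Finset.Icc a b).card : ℝ) * |(r : ℝ)| / (q : ℝ) ^ lam + |(r : ℝ)| := by
  have hQ : (0 : ℤ) < (q : ℤ) ^ lam := by positivity
  obtain ⟨R, hR, hmem⟩ := exists_residues_of_ediv_ne hQ r
  have hsub : (Finset.Icc a b).filter (fun n =>
      (s q (n + r).toNat : ℤ) - (s q n.toNat : ℤ) ≠
      (sTrunc q lam (n + r) : ℤ) - (sTrunc q lam n : ℤ)) ⊆
      R.biUnion fun c => (Finset.Icc a b).filter (fun n => n % (q : ℤ) ^ lam = c) := by
    intro n hn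
    rw [Finset.mem_filter] at hn
    obtain ⟨hnI, hne⟩ := hn
    obtain ⟨h0, h1⟩ := hI n hnI
    refine Finset.mem_biUnion.2 ⟨_, hmem n fun heq => hne ?_, Finset.mem_filter.2 ⟨hnI, rfl⟩⟩
    rw [s_toNat_eq_sTrunc_add hq lam h0, s_toNat_eq_sTrunc_add hq lam h1, heq]
    push_cast
    ring
  have hRr : (R.card : ℝ) = |(r : ℝ)| := by
    rw [hR, Nat.cast_natAbs, Int.cast_abs]
  calc _ ≤ ((R.biUnion fun c =>
        (Finset.Icc a b).filter (fun n => n % (q : ℤ) ^ lam = c)).card : ℝ) := by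
        exact_mod_cast Finset.card_le_card hsub
    _ ≤ ∑ c ∈ R, (((Finset.Icc a b).filter (fun n => n % (q : ℤ) ^ lam = c)).card : ℝ) := by
        exact_mod_cast Finset.card_biUnion_le
    _ ≤ ∑ _c ∈ R, (((Finset.Icc a b).card : ℝ) / ((q : ℤ) ^ lam : ℤ) + 1) :=
        Finset.sum_le_sum fun c _ => card_filter_emod_eq_le hQ a b c
    _ = _ := by
        rw [Finset.sum_const, nsmul_eq_mul, hRr]
        push_cast
        ring
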